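/- There exists a positive constant c2 such that for every connected Eulerian digraph G on n vertices, every starting vertex v, and every 1 ≤ k ≤ n, the simple random walk on G started at v satisfies E_v[T_k] ≤ c2·k³, where T_k = inf{t ≥ 0 : #{X_0, X_1, …, X_t} = k} is the first time the walk has visited k distinct vertices. -/

import Mathlib

open Finset

/-- The out-degree of a vertex in a digraph. -/
def dout {V : Type} [Fintype V] (E : V → V → Prop) [DecidableRel E] (x : V) : ℕ :=
  (Finset.univ.filter fun y => E x y).card

/-- The in-degree of a vertex in a digraph. -/
def din {V : Type} [Fintype V] (E : V → V → Prop) [DecidableRel E] (x : V) : ℕ :=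
  (Finset.univ.filter fun y => E y x).card

/-- The number of directed edges of a digraph. -/
def numEdges {V : Type} [Fintype V] (E : V → V → Prop) [DecidableRel E] : ℕ :=
  ∑ x, dout E x

/-- The transition matrix of the (non-lazy) simple random walk on a digraph. -/
noncomputable def srwP {V : Type} [Fintype V] [DecidableEq V] (E : V → V → Prop)
    [DecidableRel E] : Matrix V V ℝ :=
  fun v w => if E v w then 1 / (dout E v : ℝ) else 0

/-- The probability that a Markov chain with transition matrix `P` follows the trajectory
`x 0, x 1, …, x t` (given that it starts at `x 0`). -/
noncomputable def pathWeight {V : Type} [Fintype V] (P : Matrix V V ℝ) {t : ℕ}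
    (x : Fin (t + 1) → V) : ℝ :=
  ∏ i : Fin t, P (x i.castSucc) (x i.succ)

/-- `exploreSurv P v k t` is the probability, for the chain with transition matrix `P` started
at `v`, that fewer than `k` distinct vertices have been visited by time `t`; that is,
`P_v(T_k > t)` where `T_k` is the first time `k` distinct vertices have been visited. -/
noncomputable def exploreSurv {V : Type} [Fintype V] [DecidableEq V] (P : Matrix V V ℝ)
    (v : V) (k t : ℕ) : ℝ :=
  ∑ x : Fin (t + 1) → V,
    if x 0 = v ∧ (Finset.univ.image x).card < k then pathWeight P x else 0

section Reward

variable {V : Type} [Fintype V] [DecidableEq V]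

/-- The expected total reward collected during the first `T` steps of the exploration from `x`
with visited set `B`, stopped once `k` vertices are visited. Each step at `y` earns `c y` and
multiplies later rewards by `w y`. -/
noncomputable def rewardSum (P : Matrix V V ℝ) (c w : V → ℝ) (k : ℕ) : ℕ → Finset V → V → ℝ
  | 0, _, _ => 0
  | T + 1, B, x =>
    if #B < k then c x + w x * ∑ z, P x z * rewardSum P c w k T (insert z B) z else 0

theorem rewardSum_of_le {P : Matrix V V ℝ} {c w : V → ℝ} {k : ℕ} (T : ℕ) {B : Finset V} (x : V)
    (h : k ≤ #B) : rewardSum P c w k T B x = 0 := by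
  cases T with
  | zero => rfl
  | succ T => simp [rewardSum, not_lt.2 h]

theorem rewardSum_nonneg {P : Matrix V V ℝ} {c w : V → ℝ} {k : ℕ} (hP : ∀ x z, 0 ≤ P x z)
    (hc : ∀ x, 0 ≤ c x) (hw : ∀ x, 0 ≤ w x) (T : ℕ) (B : Finset V) (x : V) :
    0 ≤ rewardSum P c w k T B x := by
  induction T generalizing B x with
  | zero => simp [rewardSum]
  | succ T ih =>
    rw [rewardSum]
    split_ifs
    · exact add_nonneg (hc x)
        (mul_nonneg (hw x) (sum_nonneg fun z _ => mul_nonneg (hP x z) (ih _ _)))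
    · exact le_rfl

theorem rewardSum_anti {P : Matrix V V ℝ} {c w : V → ℝ} {k : ℕ} (hP : ∀ x z, 0 ≤ P x z)
    (hc : ∀ x, 0 ≤ c x) (hw : ∀ x, 0 ≤ w x) (T : ℕ) {B B' : Finset V} (hB : B ⊆ B') (x : V) :
    rewardSum P c w k T B' x ≤ rewardSum P c w k T B x := by
  induction T generalizing B B' x with
  | zero => simp [rewardSum]
  | succ T ih =>
    by_cases h : #B' < k
    · have h' : #B < k := (card_le_card hB).trans_lt h
      simp only [rewardSum, h, h', if_true]
      gcongr with z
      · exact hw x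
      · exact hP x z
      · exact ih (insert_subset_insert z hB) z
    · rw [rewardSum_of_le _ _ (not_lt.1 h)]
      exact rewardSum_nonneg hP hc hw _ _ _

theorem rewardSum_le_succ {P : Matrix V V ℝ} {c w : V → ℝ} {k : ℕ} (hP : ∀ x z, 0 ≤ P x z)
    (hc : ∀ x, 0 ≤ c x) (hw : ∀ x, 0 ≤ w x) (T : ℕ) (B : Finset V) (x : V) :
    rewardSum P c w k T B x ≤ rewardSum P c w k (T + 1) B x := by
  induction T generalizing B x with
  | zero => exact rewardSum_nonneg hP hc hw _ _ _
  | succ T ih =>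
    by_cases h : #B < k
    · rw [rewardSum, rewardSum]
      simp only [h, if_true]
      gcongr with z
      · exact hw x
      · exact hP x z
      · exact ih _ _
    · rw [rewardSum_of_le _ _ (not_lt.1 h), rewardSum_of_le _ _ (not_lt.1 h)]

theorem rewardSum_mono {P : Matrix V V ℝ} {c w : V → ℝ} {k : ℕ} (hP : ∀ x z, 0 ≤ P x z)
    (hc : ∀ x, 0 ≤ c x) (hw : ∀ x, 0 ≤ w x) (B : Finset V) (x : V) :
    Monotone fun T => rewardSum P c w k T B x :=
  monotone_nat_of_le_succ fun T => rewardSum_le_succ hP hc hw T B x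

/-- Supersolutions of the one-step recursion dominate `rewardSum`. -/
theorem rewardSum_le_of_supersolution {P : Matrix V V ℝ} {c w : V → ℝ} {k : ℕ}
    (hP : ∀ x z, 0 ≤ P x z) (hw : ∀ x, 0 ≤ w x) (Ψ : ℕ → Finset V → V → ℝ)
    (h0 : ∀ T B x, x ∈ B → #B ≤ k → 0 ≤ Ψ T B x)
    (hstep : ∀ T B x, x ∈ B → #B < k →
      c x + w x * ∑ z, P x z * Ψ T (insert z B) z ≤ Ψ (T + 1) B x)
    (T : ℕ) (B : Finset V) (x : V) (hx : x ∈ B) (hB : #B ≤ k) :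
    rewardSum P c w k T B x ≤ Ψ T B x := by
  induction T generalizing B x with
  | zero => exact h0 _ _ _ hx hB
  | succ T ih =>
    rcases hB.lt_or_eq with h | h
    · refine le_trans ?_ (hstep T B x hx h)
      simp only [rewardSum, h, if_true]
      gcongr with z
      · exact hw x
      · exact hP x z
      · exact ih _ _ (mem_insert_self _ _) ((card_insert_le _ _).trans h)
    · rw [rewardSum_of_le _ _ h.ge]
      exact h0 _ _ _ hx hB

/-- If the discounted reward, with discount `w` and reward `w * c`, is at most `K`, and the
discount is `1 - w = w * c * ε` with `ε * K ≤ 1 / 2`, then the undiscounted reward is at most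
`2 * K`. -/
theorem rewardSum_le_of_discounted {P : Matrix V V ℝ} {c w : V → ℝ} {k : ℕ}
    (hP : ∀ x z, 0 ≤ P x z) (hc : ∀ x, 0 ≤ c x) (hw : ∀ x, 0 ≤ w x) {ε K : ℝ} (hε : 0 ≤ ε)
    (hwc : ∀ x, 1 - w x = w x * c x * ε) (hεK : ε * K ≤ 1 / 2) {T : ℕ}
    (hK : ∀ v, rewardSum P (fun x => w x * c x) w k T {v} v ≤ K) (v : V) :
    rewardSum P c 1 k T {v} v ≤ 2 * K := by
  have h1 : ∀ x : V, (0 : ℝ) ≤ (1 : V → ℝ) x := fun _ => zero_le_one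
  obtain ⟨m, -, hm⟩ := exists_max_image univ (fun u => rewardSum P c 1 k T {u} u) ⟨v, mem_univ v⟩
  set U := rewardSum P c 1 k T {m} m with hU
  have hU0 : 0 ≤ U := rewardSum_nonneg hP hc h1 _ _ _
  have key : ∀ t ≤ T, ∀ (B : Finset V) x, x ∈ B →
      rewardSum P c 1 k t B x ≤ (1 + ε * U) * rewardSum P (fun x => w x * c x) w k t B x := by
    intro t
    induction t with
    | zero => intro _ B x _; simp [rewardSum]
    | succ t ih =>
      intro ht B x hx
      by_cases h : #B < k
      · have hle : rewardSum P c 1 k (t + 1) B x ≤ U :=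
          (rewardSum_anti hP hc h1 _ (singleton_subset_iff.2 hx) x).trans
            ((rewardSum_mono hP hc h1 {x} x ht).trans (hm x (mem_univ x)))
        have hsum : ∑ z, P x z * rewardSum P c 1 k t (insert z B) z ≤
            (1 + ε * U) * ∑ z, P x z * rewardSum P (fun x => w x * c x) w k t (insert z B) z := by
          rw [mul_sum]
          refine sum_le_sum fun z _ => ?_
          rw [mul_left_comm]
          exact mul_le_mul_of_nonneg_left (ih (by omega) _ _ (mem_insert_self _ _)) (hP x z)
        have e : rewardSum P c 1 k (t + 1) B x =
            c x + ∑ z, P x z * rewardSum P c 1 k t (insert z B) z := by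
          simp [rewardSum, h]
        have e' : rewardSum P (fun x => w x * c x) w k (t + 1) B x = w x * c x +
            w x * ∑ z, P x z * rewardSum P (fun x => w x * c x) w k t (insert z B) z := by
          simp [rewardSum, h]
        calc rewardSum P c 1 k (t + 1) B x
            = w x * rewardSum P c 1 k (t + 1) B x
                + (1 - w x) * rewardSum P c 1 k (t + 1) B x := by ring
          _ ≤ w x * rewardSum P c 1 k (t + 1) B x + (1 - w x) * U := by
              gcongr
              rw [hwc]
              exact mul_nonneg (mul_nonneg (hw x) (hc x)) hε
          _ ≤ _ := by
              rw [e, e', hwc]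
              nlinarith [mul_le_mul_of_nonneg_left hsum (hw x)]
      · rw [rewardSum_of_le _ _ (not_lt.1 h), rewardSum_of_le _ _ (not_lt.1 h), mul_zero]
  have h2 : U ≤ (1 + ε * U) * K :=
    (key T le_rfl _ _ (mem_singleton_self m)).trans
      (mul_le_mul_of_nonneg_left (hK m) (by positivity))
  have h3 := hm v (mem_univ v)
  nlinarith

/-- The weight of the trajectories of length `t` from `v` which, together with `B`, cover fewer
than `k` vertices. -/
noncomputable def exploreSurvFrom (P : Matrix V V ℝ) (k t : ℕ) (B : Finset V) (v : V) : ℝ :=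
  ∑ x : Fin (t + 1) → V,
    if x 0 = v ∧ #(B ∪ univ.image x) < k then pathWeight P x else 0

theorem exploreSurvFrom_zero (P : Matrix V V ℝ) (k : ℕ) (B : Finset V) (v : V) :
    exploreSurvFrom P k 0 B v = if #(insert v B) < k then 1 else 0 := by
  rw [exploreSurvFrom, ← (Equiv.funUnique (Fin 1) V).symm.sum_comp]
  have : ∀ a : V, B ∪ univ.image ((Equiv.funUnique (Fin 1) V).symm a) = insert a B := by
    intro a; ext z; simp [eq_comm]
  simp only [this]
  simp [pathWeight, ite_and]

theorem exploreSurvFrom_succ (P : Matrix V V ℝ) (k t : ℕ) (B : Finset V) (v : V) :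
    exploreSurvFrom P k (t + 1) B v = ∑ z, P v z * exploreSurvFrom P k t (insert v B) z := by
  have hset : ∀ (a : V) (x : Fin (t + 1) → V),
      B ∪ univ.image (Fin.cons a x : Fin (t + 2) → V) = insert a B ∪ univ.image x := by
    intro a x; ext z; simp [Fin.exists_fin_succ, eq_comm]; tauto
  have hw : ∀ (a : V) (x : Fin (t + 1) → V),
      pathWeight P (Fin.cons a x : Fin (t + 2) → V) = P a (x 0) * pathWeight P x := by
    intro a x
    simp [pathWeight, Fin.prod_univ_succ]
  rw [exploreSurvFrom, ← (Fin.consEquiv fun _ : Fin (t + 2) => V).sum_comp, Fintype.sum_prod_type]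
  have hcons : ∀ (a : V) (x : Fin (t + 1) → V),
      Fin.consEquiv (fun _ : Fin (t + 2) => V) (a, x) = Fin.cons a x := fun _ _ => rfl
  simp only [hcons, hset, hw, Fin.cons_zero, ite_and]
  rw [sum_comm]
  simp only [sum_ite_eq', mem_univ, if_true, exploreSurvFrom, mul_sum]
  rw [sum_comm]
  refine sum_congr rfl fun x _ => ?_
  simp [ite_and]

theorem sum_exploreSurvFrom (P : Matrix V V ℝ) (k T : ℕ) (B : Finset V) (v : V) :
    ∑ t ∈ range T, exploreSurvFrom P k t B v = rewardSum P 1 1 k T (insert v B) v := by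
  induction T generalizing B v with
  | zero => simp [rewardSum]
  | succ T ih =>
    have hstep : ∑ t ∈ range (T + 1), exploreSurvFrom P k t B v =
        (if #(insert v B) < k then 1 else 0) +
          ∑ z, P v z * rewardSum P 1 1 k T (insert z (insert v B)) z := by
      rw [sum_range_succ', exploreSurvFrom_zero, add_comm]
      simp only [exploreSurvFrom_succ]
      rw [sum_comm]
      simp only [← mul_sum, ih]
    rw [hstep]
    by_cases h : #(insert v B) < k
    · simp [rewardSum, h]
    · rw [rewardSum_of_le _ _ (not_lt.1 h), if_neg h, zero_add]
      refine sum_eq_zero fun z _ => ?_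
      rw [rewardSum_of_le _ _ ((not_lt.1 h).trans (card_le_card (subset_insert _ _))), mul_zero]

theorem sum_exploreSurv (P : Matrix V V ℝ) (v : V) (k T : ℕ) :
    ∑ t ∈ range T, exploreSurv P v k t = rewardSum P 1 1 k T {v} v := by
  rw [← insert_empty_eq v, ← sum_exploreSurvFrom]
  simp [exploreSurv, exploreSurvFrom]

end Reward

section Dirichlet

/-- A path from `y` to a vertex outside `S` gives a short injective sequence leaving `S`. -/
theorem exists_injOn_exit {V : Type} {H : SimpleGraph V} (hH : H.Connected) (S : Finset V) {y z : V}
    (hz : z ∉ S) : ∃ (u : ℕ → V) (r : ℕ), u 0 = y ∧ u r ∉ S ∧ r ≤ #S ∧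
      Set.InjOn u (Set.Iio r) ∧ ∀ i < r, H.Adj (u i) (u (i + 1)) := by
  classical
  obtain ⟨p, hp⟩ := (hH.preconnected y z).exists_isPath
  have hex : ∃ i, p.getVert i ∉ S := ⟨p.length, by simpa using hz⟩
  have hle : Nat.find hex ≤ p.length := Nat.find_min' hex (by simpa using hz)
  have hinj : Set.InjOn p.getVert (Set.Iio (Nat.find hex)) :=
    hp.getVert_injOn.mono fun i hi => (Set.mem_Iio.1 hi).le.trans hle
  refine ⟨p.getVert, Nat.find hex, by simp, Nat.find_spec hex, ?_, hinj, fun i hi =>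
    p.adj_getVert_succ (hi.trans_le hle)⟩
  rw [← card_range (Nat.find hex)]
  refine card_le_card_of_injOn p.getVert (fun i hi => ?_) (by simpa using hinj)
  simpa using Nat.find_min hex (mem_range.1 hi)

variable {V : Type} [Fintype V]

/-- The Laplacian of the weights `q`. -/
def weightLaplacian (q : V → V → ℝ) (f : V → ℝ) (x : V) : ℝ :=
  (∑ z, q x z) * f x - ∑ z, q x z * f z

/-- Twice the Dirichlet energy of `f` for the weights `q`. -/
def dirichletEnergy (q : V → V → ℝ) (f : V → ℝ) : ℝ :=
  ∑ x, ∑ z, q x z * (f x - f z) ^ 2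

variable {q : V → V → ℝ}

theorem dirichletEnergy_nonneg (hq : ∀ x z, 0 ≤ q x z) (f : V → ℝ) : 0 ≤ dirichletEnergy q f :=
  sum_nonneg fun x _ => sum_nonneg fun z _ => mul_nonneg (hq x z) (sq_nonneg _)

/-- For balanced weights, the quadratic form of the Laplacian is half of `dirichletEnergy`. -/
theorem sum_mul_weightLaplacian (hbal : ∀ x, ∑ z, q x z = ∑ z, q z x) (f : V → ℝ) :
    ∑ x, f x * weightLaplacian q f x = dirichletEnergy q f / 2 := by
  have h1 : ∑ x, ∑ z, q x z * f z ^ 2 = ∑ x, ∑ z, q x z * f x ^ 2 := by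
    rw [sum_comm]
    simp only [← sum_mul, hbal]
  have h2 : dirichletEnergy q f =
      ∑ x, ∑ z, q x z * f x ^ 2 + ∑ x, ∑ z, q x z * f z ^ 2
        - 2 * ∑ x, ∑ z, q x z * (f x * f z) := by
    simp only [dirichletEnergy, mul_sum, ← sum_add_distrib, ← sum_sub_distrib]
    exact sum_congr rfl fun x _ => sum_congr rfl fun z _ => by ring
  have h3 : ∑ x, f x * weightLaplacian q f x =
      ∑ x, ∑ z, q x z * f x ^ 2 - ∑ x, ∑ z, q x z * (f x * f z) := by
    simp only [weightLaplacian, mul_sub, sum_mul, mul_sum, ← sum_sub_distrib]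
    exact sum_congr rfl fun x _ => sum_congr rfl fun z _ => by ring
  rw [h2, h3, h1]
  ring

theorem sum_weightLaplacian (hbal : ∀ x, ∑ z, q x z = ∑ z, q z x) (f : V → ℝ) :
    ∑ x, weightLaplacian q f x = 0 := by
  simp only [weightLaplacian, sum_sub_distrib, hbal, sum_mul]
  rw [sum_comm, sub_self]

theorem weightLaplacian_sub (f g : V → ℝ) (x : V) :
    weightLaplacian q (fun y => f y - g y) x = weightLaplacian q f x - weightLaplacian q g x := by
  simp only [weightLaplacian, mul_sub, sum_sub_distrib]
  ring

theorem weightLaplacian_nonpos_of_isMin (hq : ∀ x z, 0 ≤ q x z) {f : V → ℝ} {x : V}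
    (hx : ∀ z, f x ≤ f z) : weightLaplacian q f x ≤ 0 := by
  rw [weightLaplacian, sum_mul, sub_nonpos]
  exact sum_le_sum fun z _ => mul_le_mul_of_nonneg_left (hx z) (hq x z)

variable [DecidableEq V]

/-- Along an injective sequence of `r` adjacent vertices, the increment of `f` is controlled by
its energy. -/
theorem sq_sub_le_of_injOn (hq : ∀ x z, 0 ≤ q x z) (f : V → ℝ) (u : ℕ → V) (r : ℕ)
    (hinj : Set.InjOn u (Set.Iio r)) (hadj : ∀ i < r, 1 ≤ q (u i) (u (i + 1)) + q (u (i + 1)) (u i)) :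
    (f (u 0) - f (u r)) ^ 2 ≤ 2 * r * dirichletEnergy q f := by
  have hsym : ∑ x, ∑ z, (q x z + q z x) * (f x - f z) ^ 2 = 2 * dirichletEnergy q f := by
    simp only [add_mul, sum_add_distrib]
    rw [two_mul, dirichletEnergy]
    congr 1
    rw [sum_comm]
    exact sum_congr rfl fun x _ => sum_congr rfl fun z _ => by ring
  have hnn : ∀ x z, 0 ≤ (q x z + q z x) * (f x - f z) ^ 2 := fun x z =>
    mul_nonneg (add_nonneg (hq x z) (hq z x)) (sq_nonneg _)
  have hpath : ∑ i ∈ range r, (f (u i) - f (u (i + 1))) ^ 2 ≤ 2 * dirichletEnergy q f := by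
    rw [← hsym]
    calc ∑ i ∈ range r, (f (u i) - f (u (i + 1))) ^ 2
        ≤ ∑ i ∈ range r, ∑ z, (q (u i) z + q z (u i)) * (f (u i) - f z) ^ 2 := by
          refine sum_le_sum fun i hi => ?_
          refine le_trans ?_ (single_le_sum (fun z _ => hnn (u i) z) (mem_univ (u (i + 1))))
          exact le_mul_of_one_le_left (sq_nonneg _) (hadj i (mem_range.1 hi))
      _ = ∑ x ∈ (range r).image u, ∑ z, (q x z + q z x) * (f x - f z) ^ 2 := by
          rw [sum_image]
          simpa using hinj
      _ ≤ _ := sum_le_sum_of_subset_of_nonneg (subset_univ _)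
          fun x _ _ => sum_nonneg fun z _ => hnn x z
  rw [← sum_range_sub' fun i => f (u i)]
  calc (∑ i ∈ range r, (f (u i) - f (u (i + 1)))) ^ 2
      ≤ #(range r) * ∑ i ∈ range r, (f (u i) - f (u (i + 1))) ^ 2 := sq_sum_le_card_mul_sum_sq
    _ ≤ r * (2 * dirichletEnergy q f) := by
        rw [card_range]
        gcongr
    _ = _ := by ring

theorem sq_sub_le_of_adj (hq : ∀ x z, 0 ≤ q x z) (f : V → ℝ) {x y : V}
    (hadj : 1 ≤ q x y + q y x) : (f x - f y) ^ 2 ≤ 2 * dirichletEnergy q f := by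
  have h := sq_sub_le_of_injOn hq f (fun i => if i = 0 then x else y) 1
    (fun i hi j hj _ => by simp at hi hj; omega) (fun i hi => by simpa [Nat.lt_one_iff.1 hi])
  simpa using h

theorem eq_of_dirichletEnergy_eq_zero {H : SimpleGraph V} (hH : H.Connected)
    (hq : ∀ x z, 0 ≤ q x z) (hadj : ∀ x z, H.Adj x z → 1 ≤ q x z + q z x) {f : V → ℝ}
    (hf : dirichletEnergy q f = 0) (x y : V) : f x = f y := by
  obtain ⟨p⟩ := hH.preconnected x y
  induction p with
  | nil => rfl
  | cons h _ ih =>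
    have := sq_sub_le_of_adj hq f (hadj _ _ h)
    rw [hf, mul_zero] at this
    rw [← ih]
    exact sub_eq_zero.1 (pow_eq_zero_iff two_ne_zero |>.1 (le_antisymm this (sq_nonneg _)))

/-- The Laplacian with a nontrivial killing rate `κ` is invertible. -/
theorem exists_weightLaplacian_add_eq {H : SimpleGraph V} (hH : H.Connected)
    (hq : ∀ x z, 0 ≤ q x z) (hbal : ∀ x, ∑ z, q x z = ∑ z, q z x)
    (hadj : ∀ x z, H.Adj x z → 1 ≤ q x z + q z x) {κ : V → ℝ} (hκ : ∀ x, 0 ≤ κ x) {y : V}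
    (hy : 0 < κ y) (b : V → ℝ) :
    ∃ f : V → ℝ, ∀ x, weightLaplacian q f x + κ x * f x = b x := by
  let M : (V → ℝ) →ₗ[ℝ] (V → ℝ) :=
    { toFun := fun f x => weightLaplacian q f x + κ x * f x
      map_add' := fun f g => by
        funext x
        simp only [weightLaplacian, Pi.add_apply, mul_add, sum_add_distrib]
        ring
      map_smul' := fun a f => by
        funext x
        have : ∑ z, q x z * (a * f z) = a * ∑ z, q x z * f z := by
          rw [mul_sum]
          exact sum_congr rfl fun z _ => by ring
        simp only [weightLaplacian, Pi.smul_apply, smul_eq_mul, RingHom.id_apply, this]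
        ring }
  have hinj : Function.Injective M := by
    rw [← LinearMap.ker_eq_bot, LinearMap.ker_eq_bot']
    intro f hf
    have h0 : ∀ x, weightLaplacian q f x + κ x * f x = 0 := fun x => congrFun hf x
    have h1 : dirichletEnergy q f / 2 + ∑ x, κ x * f x ^ 2 = 0 := by
      rw [← sum_mul_weightLaplacian hbal, ← sum_add_distrib]
      refine sum_eq_zero fun x _ => ?_
      linear_combination f x * h0 x
    have h2 := dirichletEnergy_nonneg hq f
    have h3 : κ y * f y ^ 2 ≤ ∑ x, κ x * f x ^ 2 :=
      single_le_sum (f := fun x => κ x * f x ^ 2)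
        (fun x _ => mul_nonneg (hκ x) (sq_nonneg _)) (mem_univ y)
    have h4 : 0 ≤ κ y * f y ^ 2 := mul_nonneg (hκ y) (sq_nonneg _)
    have h5 : f y = 0 := by
      have : κ y * f y ^ 2 = 0 := by linarith
      simpa [hy.ne'] using this
    funext x
    rw [eq_of_dirichletEnergy_eq_zero hH hq hadj (by linarith : dirichletEnergy q f = 0) x y, h5]
    rfl
  obtain ⟨f, hf⟩ := LinearMap.injective_iff_surjective.1 hinj b
  exact ⟨f, fun x => congrFun hf x⟩

/-- Nonnegative Green functions for the constant killing rate `ε`, with a diagonal bound. -/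
theorem exists_green {H : SimpleGraph V} (hH : H.Connected)
    (hq : ∀ x z, 0 ≤ q x z) (hbal : ∀ x, ∑ z, q x z = ∑ z, q z x)
    (hadj : ∀ x z, H.Adj x z → 1 ≤ q x z + q z x) {ε G : ℝ} (hε : 0 < ε) {L : ℕ}
    (hL : L ≤ Fintype.card V) (hG : 16 * L ≤ G) (hG' : 4 ≤ G * (ε * L)) (y : V) :
    ∃ g : V → ℝ, (∀ x, weightLaplacian q g x + ε * g x = if x = y then 1 else 0) ∧
      (∀ x, 0 ≤ g x) ∧ g y ≤ G := by
  obtain ⟨g, hg⟩ := exists_weightLaplacian_add_eq hH hq hbal hadj (κ := fun _ => ε)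
    (fun _ => hε.le) (y := y) hε fun x => if x = y then 1 else 0
  have hg0 : ∀ x, 0 ≤ g x := by
    obtain ⟨m, -, hm⟩ := exists_min_image univ g ⟨y, mem_univ y⟩
    have h1 := weightLaplacian_nonpos_of_isMin hq fun z => hm z (mem_univ z)
    have h2 : 0 ≤ weightLaplacian q g m + ε * g m := by
      rw [hg]; split_ifs <;> norm_num
    have h3 : 0 ≤ g m := by
      by_contra h
      nlinarith
    exact fun x => h3.trans (hm x (mem_univ x))
  refine ⟨g, hg, hg0, ?_⟩
  have hE : dirichletEnergy q g / 2 + ε * ∑ x, g x ^ 2 = g y := by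
    have : ∑ x, g x * (weightLaplacian q g x + ε * g x) = g y := by simp [hg]
    rw [← this, ← sum_mul_weightLaplacian hbal, mul_sum, ← sum_add_distrib]
    exact sum_congr rfl fun x _ => by ring
  have hE0 := dirichletEnergy_nonneg hq g
  have hS0 : 0 ≤ ε * ∑ x, g x ^ 2 := mul_nonneg hε.le (sum_nonneg fun x _ => sq_nonneg _)
  have hGnn : 0 ≤ G := le_trans (by positivity) hG
  rcases (hg0 y).eq_or_lt with h0 | hpos
  · rwa [← h0]
  set S := univ.filter fun x => g y / 2 < g x with hS
  by_cases hcard : L ≤ #S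
  · have h1 : (L : ℝ) * (g y / 2) ^ 2 ≤ ∑ x, g x ^ 2 := by
      calc (L : ℝ) * (g y / 2) ^ 2 ≤ #S * (g y / 2) ^ 2 := by gcongr
        _ = ∑ x ∈ S, (g y / 2) ^ 2 := by simp
        _ ≤ ∑ x ∈ S, g x ^ 2 := sum_le_sum fun x hx => by
            have := (mem_filter.1 hx).2
            gcongr
        _ ≤ _ := sum_le_sum_of_subset_of_nonneg (subset_univ _) fun x _ _ => sq_nonneg _
    have h2 : ε * (L * (g y / 2) ^ 2) ≤ g y := by
      have := mul_le_mul_of_nonneg_left h1 hε.le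
      linarith
    have h3 : ε * L * g y ≤ 4 := by
      refine le_of_mul_le_mul_right ?_ hpos
      nlinarith
    have h4 : 0 < ε * L := by
      rcases (mul_nonneg hε.le (Nat.cast_nonneg (α := ℝ) L)).eq_or_lt with h | h
      · rw [← h] at hG'; norm_num at hG'
      · exact h
    refine le_of_mul_le_mul_left ?_ h4
    linarith
  · obtain ⟨z, hz⟩ : ∃ z, z ∉ S := by
      by_contra! h
      exact hcard (by rwa [eq_univ_iff_forall.2 h, card_univ])
    obtain ⟨u, r, hu0, hur, hr, hinj, hu⟩ := exists_injOn_exit (y := y) hH S hz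
    have h1 := sq_sub_le_of_injOn hq g u r hinj fun i hi => hadj _ _ (hu i hi)
    have h2 : g (u r) ≤ g y / 2 := by simpa [hS] using hur
    rw [hu0] at h1
    have h3 : (r : ℝ) ≤ L := by exact_mod_cast (hr.trans (not_le.1 hcard).le)
    have h4 : (g y / 2) ^ 2 ≤ (g y - g (u r)) ^ 2 := by
      gcongr
      linarith
    have h5 : 2 * r * dirichletEnergy q g ≤ 2 * L * (2 * g y) := by
      gcongr
      linarith
    have h6 : g y ≤ 16 * L := by
      refine le_of_mul_le_mul_right ?_ hpos
      nlinarith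
    exact h6.trans hG

/-- Hitting-time functions for the clock that gives mass one to every vertex. -/
theorem exists_hitting {H : SimpleGraph V} (hH : H.Connected)
    (hq : ∀ x z, 0 ≤ q x z) (hbal : ∀ x, ∑ z, q x z = ∑ z, q z x)
    (hadj : ∀ x z, H.Adj x z → 1 ≤ q x z + q z x) :
    ∃ h : V → V → ℝ, (∀ y x, weightLaplacian q (h y) x =
        1 - if x = y then (Fintype.card V : ℝ) else 0) ∧
      (∀ y, h y y = 0) ∧ (∀ y x, 0 ≤ h y x) ∧
      ∀ x y, H.Adj x y → h y x ≤ 4 * Fintype.card V := by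
  have hex : ∀ y, ∃ f : V → ℝ, (∀ x, weightLaplacian q f x =
      1 - if x = y then (Fintype.card V : ℝ) else 0) ∧ f y = 0 ∧ ∀ x, 0 ≤ f x := by
    intro y
    obtain ⟨f, hf⟩ := exists_weightLaplacian_add_eq hH hq hbal hadj
      (κ := fun x => if x = y then 1 else 0) (fun x => by split_ifs <;> norm_num) (y := y)
      (by simp) fun _ => 1
    have hfy : f y = Fintype.card V := by
      have : ∑ x, (weightLaplacian q f x + (if x = y then 1 else 0) * f x) = Fintype.card V := by
        simp only [hf, sum_const, card_univ, nsmul_eq_mul, mul_one]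
      simpa [sum_add_distrib, sum_weightLaplacian hbal] using this
    have hlap : ∀ x, weightLaplacian q (fun x => f x - f y) x =
        1 - if x = y then (Fintype.card V : ℝ) else 0 := by
      intro x
      have hconst : weightLaplacian q (fun _ => f y) x = 0 := by
        simp [weightLaplacian, sum_mul]
      rw [weightLaplacian_sub f (fun _ => f y), hconst, sub_zero, ← hf x]
      by_cases hxy : x = y
      · subst hxy
        simp [hfy]
      · simp [hxy]
    refine ⟨fun x => f x - f y, hlap, sub_self _, fun x => ?_⟩
    obtain ⟨m, -, hm⟩ := exists_min_image univ (fun x => f x - f y) ⟨y, mem_univ y⟩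
    have h1 := weightLaplacian_nonpos_of_isMin (f := fun x => f x - f y) hq
      fun z => hm z (mem_univ z)
    rw [hlap] at h1
    have hmy : m = y := by
      by_contra h
      norm_num [h] at h1
    have := hm x (mem_univ x)
    rw [hmy] at this
    simpa using this
  choose h hlap hself hnn using hex
  refine ⟨h, hlap, hself, hnn, fun x y hxy => ?_⟩
  set f : V → ℝ := fun z => h y z - h x z with hf
  have hfl : ∀ z, weightLaplacian q f z =
      (if z = x then (Fintype.card V : ℝ) else 0) - if z = y then (Fintype.card V : ℝ) else 0 := by
    intro z
    rw [hf, weightLaplacian_sub, hlap, hlap]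
    ring
  have hE := sum_mul_weightLaplacian hbal f
  simp only [hfl, mul_sub, sum_sub_distrib, mul_ite, mul_zero, sum_ite_eq', mem_univ,
    if_true] at hE
  have h1 := sq_sub_le_of_adj hq f (hadj _ _ hxy)
  have h2 : f x - f y = h y x + h x y := by simp [hf, hself]
  have h3 := hnn x y
  have h4 := hnn y x
  rw [h2] at h1
  have h5 : dirichletEnergy q f = 2 * Fintype.card V * (h y x + h x y) := by
    rw [← h2]; linarith
  rw [h5] at h1
  by_contra! hc
  have : (0 : ℝ) ≤ Fintype.card V := Nat.cast_nonneg _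
  nlinarith

end Dirichlet

section Tour

variable {V : Type}

/-- The cost of visiting the vertices of a list in order, starting from `x`. -/
def tourCost (h : V → V → ℝ) : V → List V → ℝ
  | _, [] => 0
  | x, y :: l => h y x + tourCost h y l

theorem tourCost_nonneg {h : V → V → ℝ} (hnn : ∀ y x, 0 ≤ h y x) (x : V) (l : List V) :
    0 ≤ tourCost h x l := by
  induction l generalizing x with
  | nil => exact le_rfl
  | cons y l ih => exact add_nonneg (hnn _ _) (ih y)

theorem tourCost_le_of_isChain {H : SimpleGraph V} {h : V → V → ℝ} {C : ℝ}
    (hC : ∀ x y, H.Adj x y → h y x ≤ C) (x : V) (l : List V) (hl : (x :: l).IsChain H.Adj) :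
    tourCost h x l ≤ l.length * C := by
  induction l generalizing x with
  | nil => simp [tourCost]
  | cons y l ih =>
    rw [List.isChain_cons_cons] at hl
    have h1 := hC _ _ hl.1
    have h2 := ih y hl.2
    simp only [tourCost, List.length_cons, Nat.cast_add, Nat.cast_one]
    linarith

variable [Fintype V] [DecidableEq V]

/-- In a connected graph, some walk from `v` of length at most `2 * j` visits `j` vertices. -/
theorem exists_tour {H : SimpleGraph V} (hH : H.Connected) (v : V) (j : ℕ)
    (hj : j ≤ Fintype.card V) :
    ∃ l : List V, l.IsChain H.Adj ∧ l.head? = some v ∧ l.length ≤ 2 * j + 1 ∧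
      j ≤ #l.toFinset := by
  induction j with
  | zero => exact ⟨[v], by simp, rfl, by simp, by simp⟩
  | succ j ih =>
    obtain ⟨l, hl, hv, hlen, hcard⟩ := ih (by omega)
    by_cases h : j + 1 ≤ #l.toFinset
    · exact ⟨l, hl, hv, by omega, h⟩
    obtain ⟨z, hz⟩ : ∃ z, z ∉ l.toFinset := by
      by_contra! hall
      rw [eq_univ_iff_forall.2 hall, card_univ] at h
      omega
    obtain ⟨p⟩ := hH.preconnected v z
    have hvl : v ∈ l.toFinset := List.mem_toFinset.2 (List.mem_of_mem_head? hv)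
    obtain ⟨d, -, hd, hd'⟩ := p.exists_boundary_dart (l.toFinset : Set V) hvl hz
    obtain ⟨a, b, rfl⟩ := List.append_of_mem (List.mem_toFinset.1 hd)
    refine ⟨a ++ d.fst :: d.snd :: d.fst :: b, ?_, ?_, ?_, ?_⟩
    · rw [List.isChain_split] at hl ⊢
      refine ⟨hl.1, ?_⟩
      simp only [List.isChain_cons_cons]
      exact ⟨d.adj, d.adj.symm, hl.2⟩
    · rw [← hv]
      cases a <;> rfl
    · simp only [List.length_append, List.length_cons] at hlen ⊢
      omega
    · have : (a ++ d.fst :: d.snd :: d.fst :: b).toFinset =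
          insert d.snd (a ++ d.fst :: b).toFinset := by
        ext x; simp
      rw [this, card_insert_of_notMem hd']
      omega

theorem rewardSum_le_tourCost {P : Matrix V V ℝ} {c : V → ℝ} {k : ℕ} (hk : k ≤ Fintype.card V)
    (hP : ∀ x z, 0 ≤ P x z) (hP1 : ∀ x, ∑ z, P x z = 1) {h : V → V → ℝ}
    (hself : ∀ y, h y y = 0) (hnn : ∀ y x, 0 ≤ h y x)
    (hstep : ∀ y x, x ≠ y → c x + ∑ z, P x z * h y z = h y x)
    (T : ℕ) (l : List V) (B : Finset V) (x : V) (hx : x ∈ B) (hB : ∀ z, z ∈ B ∨ z ∈ l) :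
    rewardSum P c 1 k T B x ≤ tourCost h x l := by
  induction T generalizing l B x with
  | zero => exact tourCost_nonneg hnn x l
  | succ T ih =>
    induction l with
    | nil =>
      rw [rewardSum_of_le, tourCost]
      have hBu : B = univ := eq_univ_iff_forall.2 fun z => by simpa using hB z
      rwa [hBu, card_univ]
    | cons y l ihl =>
      by_cases hxy : x = y
      · subst hxy
        rw [tourCost, hself, zero_add]
        refine ihl fun z => ?_
        rcases hB z with h | h
        · exact Or.inl h
        · rcases List.mem_cons.1 h with rfl | h
          · exact Or.inl hx
          · exact Or.inr h
      · rw [rewardSum]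
        split_ifs
        · rw [tourCost, ← hstep y x hxy, add_assoc, Pi.one_apply, one_mul]
          gcongr
          calc ∑ z, P x z * rewardSum P c 1 k T (insert z B) z
              ≤ ∑ z, P x z * (h y z + tourCost h y l) := by
                gcongr with z
                · exact hP x z
                · exact ih (y :: l) (insert z B) z (mem_insert_self _ _) fun u =>
                    (hB u).imp_left mem_insert_of_mem
            _ = _ := by simp only [mul_add, sum_add_distrib, ← sum_mul, hP1, one_mul]
        · exact tourCost_nonneg hnn _ _

end Tour

section Exploration

variable {V : Type} [Fintype V] {q : V → V → ℝ}

theorem mul_sum_normalized (hD : ∀ x, 0 < ∑ z, q x z) {P : Matrix V V ℝ}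
    (hPq : ∀ x z, P x z = q x z / ∑ y, q x y) (f : V → ℝ) (x : V) :
    (∑ z, q x z) * ∑ z, P x z * f z = ∑ z, q x z * f z := by
  rw [mul_sum]
  refine sum_congr rfl fun z _ => ?_
  rw [hPq, ← mul_assoc, mul_div_cancel₀ _ (hD x).ne']

theorem sum_normalized (hD : ∀ x, 0 < ∑ z, q x z) {P : Matrix V V ℝ}
    (hPq : ∀ x z, P x z = q x z / ∑ y, q x y) (x : V) : ∑ z, P x z = 1 := by
  simp only [hPq, ← sum_div]
  exact div_self (hD x).ne'

variable [DecidableEq V]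

/-- The discounted clock before visiting `k` vertices is at most `k` times a bound for the
diagonal of the Green function. -/
theorem rewardSum_discounted_le (hD : ∀ x, 0 < ∑ z, q x z) {P : Matrix V V ℝ}
    (hP : ∀ x z, 0 ≤ P x z) (hPq : ∀ x z, P x z = q x z / ∑ y, q x y) {ε G : ℝ} (hε : 0 < ε)
    (hG : 0 ≤ G) {g : V → V → ℝ}
    (hg : ∀ y x, weightLaplacian q (g y) x + ε * g y x = if x = y then 1 else 0)
    (hnn : ∀ y x, 0 ≤ g y x) (hdiag : ∀ y, g y y ≤ G) {k : ℕ} (hk : 1 ≤ k) (T : ℕ) (v : V) :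
    rewardSum P (fun x => (∑ z, q x z) / ((∑ z, q x z) + ε) * (1 / ∑ z, q x z))
      (fun x => (∑ z, q x z) / ((∑ z, q x z) + ε)) k T {v} v ≤ k * G := by
  have hP1 := sum_normalized hD hPq
  refine (rewardSum_le_of_supersolution hP (fun x => ?_)
    (fun _ B x => ∑ y ∈ B, g y x + ((k : ℝ) - #B) * G) ?_ ?_ T {v} v (mem_singleton_self v)
    (by simpa using hk)).trans ?_
  · have := hD x
    positivity
  · intro _ B x _ hB
    have : (#B : ℝ) ≤ k := by exact_mod_cast hB
    exact add_nonneg (sum_nonneg fun y _ => hnn y x) (mul_nonneg (by linarith) hG)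
  · intro _ B x hx hB
    have hB' : (#B : ℝ) ≤ k := by exact_mod_cast hB.le
    set D := ∑ z, q x z with hDdef
    have hDx : 0 < D := hD x
    set A := ∑ y ∈ B, ∑ z, P x z * g y z with hA
    have hnext : ∀ z, ∑ y ∈ insert z B, g y z + ((k : ℝ) - #(insert z B)) * G ≤
        ∑ y ∈ B, g y z + ((k : ℝ) - #B) * G := by
      intro z
      by_cases hz : z ∈ B
      · rw [insert_eq_of_mem hz]
      · rw [sum_insert hz, card_insert_of_notMem hz]
        have := hdiag z
        push_cast
        linarith
    have hsum : ∑ z, P x z * (∑ y ∈ insert z B, g y z + ((k : ℝ) - #(insert z B)) * G) ≤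
        A + ((k : ℝ) - #B) * G := by
      calc _ ≤ ∑ z, P x z * (∑ y ∈ B, g y z + ((k : ℝ) - #B) * G) :=
            sum_le_sum fun z _ => mul_le_mul_of_nonneg_left (hnext z) (hP x z)
        _ = _ := by
            simp only [mul_add, sum_add_distrib, ← sum_mul, hP1, one_mul, hA, mul_sum]
            rw [sum_comm]
    have hgreen : (D + ε) * ∑ y ∈ B, g y x = 1 + D * A := by
      have h1 : ∑ y ∈ B, (if x = y then (1 : ℝ) else 0) = 1 := by simp [hx]
      rw [← h1, hA, mul_sum, mul_sum, ← sum_add_distrib]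
      refine sum_congr rfl fun y _ => ?_
      rw [← hg y x, hDdef, mul_sum_normalized hD hPq, weightLaplacian]
      ring
    have hκ : 0 ≤ ((k : ℝ) - #B) * G := mul_nonneg (by linarith) hG
    have hw : 0 ≤ D / (D + ε) := by positivity
    refine (add_le_add_right (mul_le_mul_of_nonneg_left hsum hw) _).trans ?_
    have e : D / (D + ε) * (1 / D) + D / (D + ε) * (A + ((k : ℝ) - #B) * G) =
        (1 + D * A + D * (((k : ℝ) - #B) * G)) / (D + ε) := by
      field_simp
      ring
    rw [e, ← hgreen, div_le_iff₀ (by positivity)]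
    nlinarith
  · have := hdiag v
    simp only [sum_singleton, card_singleton, Nat.cast_one]
    linarith

/-- The time to visit `k` vertices is controlled by the clock running at speed `1 / ∑ z, q x z`,
since a vertex of large degree leads to unvisited vertices. -/
theorem rewardSum_one_le (hD : ∀ x, 0 < ∑ z, q x z) {P : Matrix V V ℝ}
    (hP : ∀ x z, 0 ≤ P x z) (hPq : ∀ x z, P x z = q x z / ∑ y, q x y) (hq1 : ∀ x z, q x z ≤ 1)
    {k : ℕ} (hk : 1 ≤ k) (T : ℕ) (v : V) :
    rewardSum P 1 1 k T {v} v ≤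
      k * rewardSum P (fun x => 1 / ∑ z, q x z) 1 k T {v} v + k := by
  have hP1 := sum_normalized hD hPq
  set a := rewardSum P (fun x => 1 / ∑ z, q x z) 1 k with ha
  have hann : ∀ T B x, 0 ≤ a T B x :=
    rewardSum_nonneg hP (fun x => one_div_nonneg.2 (hD x).le) fun _ => zero_le_one
  refine (rewardSum_le_of_supersolution hP (fun _ => zero_le_one)
    (fun T B x => k * a T B x + ((k : ℝ) - #B)) ?_ ?_ T {v} v (mem_singleton_self v)
    (by simpa using hk)).trans (by simp)
  · intro T B x _ hB
    have : (#B : ℝ) ≤ k := by exact_mod_cast hB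
    have := mul_nonneg (Nat.cast_nonneg (α := ℝ) k) (hann T B x)
    linarith
  · intro T B x _ hB
    have hB' : (#B : ℝ) ≤ k := by exact_mod_cast hB.le
    have e : a (T + 1) B x = 1 / (∑ z, q x z) + ∑ z, P x z * a T (insert z B) z := by
      simp [ha, rewardSum, hB]
    have hcard : ∀ z, (#(insert z B) : ℝ) = #B + 1 - if z ∈ B then 1 else 0 := by
      intro z
      by_cases hz : z ∈ B
      · simp [hz]
      · simp [hz]
    have hret : ∑ z, P x z * (if z ∈ B then 1 else 0) ≤ k * (1 / ∑ z, q x z) := by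
      have hle : ∀ z, P x z ≤ 1 / ∑ z, q x z := fun z => by
        rw [hPq]
        exact div_le_div_of_nonneg_right (hq1 x z) (hD x).le
      calc ∑ z, P x z * (if z ∈ B then 1 else 0) = ∑ z ∈ B, P x z := by simp
        _ ≤ ∑ z ∈ B, 1 / ∑ z, q x z := sum_le_sum fun z _ => hle z
        _ = #B * (1 / ∑ z, q x z) := by rw [sum_const, nsmul_eq_mul]
        _ ≤ _ := mul_le_mul_of_nonneg_right hB' (one_div_nonneg.2 (hD x).le)
    have hsum : ∑ z, P x z * (k * a T (insert z B) z + ((k : ℝ) - #(insert z B))) =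
        k * ∑ z, P x z * a T (insert z B) z + ((k : ℝ) - #B - 1)
          + ∑ z, P x z * (if z ∈ B then 1 else 0) := by
      have hc : (k : ℝ) - #B - 1 = ∑ z, P x z * ((k : ℝ) - #B - 1) := by
        rw [← sum_mul, hP1, one_mul]
      rw [hc, mul_sum, ← sum_add_distrib, ← sum_add_distrib]
      refine sum_congr rfl fun z _ => ?_
      rw [hcard]
      ring
    rw [e, hsum, Pi.one_apply, one_mul]
    linarith

theorem rewardSum_clock_le {H : SimpleGraph V} (hH : H.Connected) (hq : ∀ x z, 0 ≤ q x z)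
    (hbal : ∀ x, ∑ z, q x z = ∑ z, q z x) (hadj : ∀ x z, H.Adj x z → 1 ≤ q x z + q z x)
    (hD : ∀ x, 0 < ∑ z, q x z) {P : Matrix V V ℝ} (hPq : ∀ x z, P x z = q x z / ∑ y, q x y)
    {k : ℕ} (hk : 1 ≤ k) (hkn : k ≤ Fintype.card V) (T : ℕ) (v : V) :
    rewardSum P (fun x => 1 / ∑ z, q x z) 1 k T {v} v ≤ 512 * (k : ℝ) ^ 2 := by
  have hP : ∀ x z, 0 ≤ P x z := fun x z => by
    rw [hPq]
    exact div_nonneg (hq x z) (hD x).le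
  have hk' : (1 : ℝ) ≤ k := by exact_mod_cast hk
  rcases le_total (8 * k) (Fintype.card V) with hn | hn
  · set ε : ℝ := 1 / (256 * (k : ℝ) ^ 2) with hεdef
    have hε : 0 < ε := by positivity
    have hgreen := exists_green hH hq hbal hadj hε (G := 128 * k) hn
      (by push_cast; linarith) (by rw [hεdef]; push_cast; field_simp; norm_num)
    choose g hg hnn hdiag using hgreen
    have h := rewardSum_le_of_discounted (c := fun x => 1 / ∑ z, q x z)
      (w := fun x => (∑ z, q x z) / ((∑ z, q x z) + ε)) (k := k) hP
      (fun x => one_div_nonneg.2 (hD x).le)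
      (fun x => div_nonneg (hD x).le (add_pos (hD x) hε).le) hε.le (K := k * (128 * k))
      (fun x => by
        have h1 := hD x
        have h2 := add_pos h1 hε
        field_simp
        ring)
      (by rw [hεdef]; field_simp; norm_num) (T := T)
      (rewardSum_discounted_le hD hP hPq hε (by positivity) hg hnn hdiag hk T) v
    refine h.trans ?_
    nlinarith
  · obtain ⟨h, hlap, hself, hnn, hedge⟩ := exists_hitting hH hq hbal hadj
    obtain ⟨l, hl, hv, hlen, hcard⟩ := exists_tour hH v _ le_rfl
    obtain ⟨l, rfl⟩ : ∃ l', l = v :: l' := by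
      cases l with
      | nil => simp at hv
      | cons a l => exact ⟨l, by simpa using hv⟩
    have huniv : (v :: l).toFinset = univ := (card_eq_iff_eq_univ _).1
      (le_antisymm (card_le_univ _) hcard)
    have h1 := rewardSum_le_tourCost (c := fun x => 1 / ∑ z, q x z) hkn hP
      (sum_normalized hD hPq) hself hnn (fun y x hxy => ?_) T l {v} v (mem_singleton_self v)
      fun z => by
        have : z ∈ (v :: l).toFinset := huniv ▸ mem_univ z
        simpa using this
    · have h2 := tourCost_le_of_isChain hedge v l hl
      have h3 : (l.length : ℝ) ≤ 2 * Fintype.card V := by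
        simp only [List.length_cons] at hlen
        exact_mod_cast (by omega : l.length ≤ 2 * Fintype.card V)
      have h4 : (Fintype.card V : ℝ) ≤ 8 * k := by exact_mod_cast hn
      calc _ ≤ _ := h1.trans h2
        _ ≤ 2 * (8 * k) * (4 * (8 * k)) := by gcongr; linarith
        _ = _ := by ring
    · have h1 := hlap y x
      rw [weightLaplacian, ← mul_sum_normalized hD hPq, if_neg hxy] at h1
      have := hD x
      field_simp
      linarith

end Exploration

/-- There is a positive constant `c2` such that for every connected Eulerian
digraph on `n` vertices, every starting vertex `v` and every `1 ≤ k ≤ n`, the simple random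
walk satisfies `E_v[T_k] ≤ c2·k³` (expressed via `E_v[T_k] = ∑_{t≥0} P_v(T_k > t)`, bounded
through all its partial sums). -/
theorem eulerian_exploration_time :
    ∃ c2 : ℝ, 0 < c2 ∧
      ∀ (V : Type) [Fintype V] [DecidableEq V] (E : V → V → Prop) [DecidableRel E],
        (∀ x, ¬ E x x) →
        (∀ x, dout E x = din E x) →
        (SimpleGraph.fromRel E).Connected →
        ∀ (v : V) (k : ℕ), 1 ≤ k → k ≤ Fintype.card V →
          ∀ T : ℕ, ∑ t ∈ Finset.range T, exploreSurv (srwP E) v k t ≤ c2 * (k : ℝ) ^ 3 := by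
  refine ⟨513, by norm_num, ?_⟩
  intro V _ _ E _ hloop hEul hconn v k hk hkn T
  rw [sum_exploreSurv]
  rcases hk.eq_or_lt with rfl | hk2
  · rw [rewardSum_of_le _ _ (by simp)]
    norm_num
  set q : V → V → ℝ := fun x z => if E x z then 1 else 0 with hqdef
  have hrow : ∀ x, ∑ z, q x z = dout E x := fun x => by simp [hqdef, dout]
  have hcol : ∀ x, ∑ z, q z x = din E x := fun x => by simp [hqdef, din]
  have hq : ∀ x z, 0 ≤ q x z := fun x z => by
    simp only [hqdef]
    split_ifs <;> norm_num
  have hq1 : ∀ x z, q x z ≤ 1 := fun x z => by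
    simp only [hqdef]
    split_ifs <;> norm_num
  have hbal : ∀ x, ∑ z, q x z = ∑ z, q z x := fun x => by rw [hrow, hcol, hEul]
  have hadj : ∀ x z, (SimpleGraph.fromRel E).Adj x z → 1 ≤ q x z + q z x := by
    intro x z h
    rcases ((SimpleGraph.fromRel_adj E x z).1 h).2 with h | h
    · have := hq z x
      simp only [hqdef, h, if_true] at this ⊢
      linarith
    · have := hq x z
      simp only [hqdef, h, if_true] at this ⊢
      linarith
  have hD : ∀ x, 0 < ∑ z, q x z := by
    intro x
    have : Nontrivial V := Fintype.one_lt_card_iff_nontrivial.1 (hk2.trans_le hkn)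
    obtain ⟨y, hy⟩ := hconn.preconnected.exists_adj_of_nontrivial x
    have h1 := hadj x y hy
    have h2 := single_le_sum (fun z _ => hq x z) (mem_univ y)
    have h3 := single_le_sum (f := fun z => q z x) (fun z _ => hq z x) (mem_univ y)
    rw [← hbal] at h3
    linarith
  have hPq : ∀ x z, srwP E x z = q x z / ∑ y, q x y := by
    intro x z
    rw [hrow]
    simp only [srwP, hqdef]
    split_ifs <;> simp
  have hP : ∀ x z, 0 ≤ srwP E x z := fun x z => by
    rw [hPq]
    exact div_nonneg (hq x z) (hD x).le
  have h1 := rewardSum_one_le hD hP hPq hq1 hk T v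
  have h2 := rewardSum_clock_le hconn hq hbal hadj hD hPq hk hkn T v
  have hk' : (1 : ℝ) ≤ k := by exact_mod_cast hk
  calc _ ≤ _ := h1
    _ ≤ k * (512 * (k : ℝ) ^ 2) + (k : ℝ) ^ 3 := by
      gcongr
      exact le_self_pow₀ hk' (by norm_num)
    _ = _ := by ring
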